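/- The unrestricted unification type of the equational theories AC and D for elementary unification is infinitary: for each E ∈ {AC, D}, every solvable elementary E-unification problem has a minimal complete set of E-unifiers w.r.t. the unrestricted instantiation preorder ≤_E^V, and there exists a solvable elementary E-unification problem that has an infinite minimal complete set of E-unifiers w.r.t. ≤_E^V but no finite one. -/

import Mathlib

namespace UnifFW

/-- First-order terms over a signature `F` (an arity-indexed family of function
symbols), with variables from the countably infinite set `V = ℕ`. -/
inductive Term (F : ℕ → Type) : Type
  | var : ℕ → Term F
  | app : (n : ℕ) → F n → (Fin n → Term F) → Term F

variable {F : ℕ → Type}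

/-- The set of variables occurring in a term. -/
def Term.vars : Term F → Set ℕ
  | .var x => {x}
  | .app _ _ ts => ⋃ i, (ts i).vars

/-- Homomorphic extension of a map `V → T(Σ,V)` to terms. -/
def Term.subst (σ : ℕ → Term F) : Term F → Term F
  | .var x => σ x
  | .app n f ts => .app n f (fun i => (ts i).subst σ)

/-- The congruence `≈_E` induced by a set `E` of identities: the smallest
equivalence relation containing all substitution instances of identities of `E`
and compatible with the term constructors. -/
inductive EqE (E : Set (Term F × Term F)) : Term F → Term F → Prop
  | ax {s t : Term F} (σ : ℕ → Term F) : (s, t) ∈ E → EqE E (s.subst σ) (t.subst σ)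
  | refl (t : Term F) : EqE E t t
  | symm {s t : Term F} : EqE E s t → EqE E t s
  | trans {s t u : Term F} : EqE E s t → EqE E t u → EqE E s u
  | congr {n : ℕ} (f : F n) {ts us : Fin n → Term F} :
      (∀ i, EqE E (ts i) (us i)) → EqE E (.app n f ts) (.app n f us)

/-- A theory is non-trivial if distinct variables are not equated. -/
def NonTrivial (E : Set (Term F × Term F)) : Prop :=
  ∀ x y : ℕ, x ≠ y → ¬ EqE E (.var x) (.var y)

/-- A theory is regular if both sides of each identity have the same variables. -/
def Regular (E : Set (Term F × Term F)) : Prop :=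
  ∀ p ∈ E, (Prod.fst p).vars = (Prod.snd p).vars

/-- A substitution: a map `V → T(Σ,V)` with finite domain. -/
structure Subst (F : ℕ → Type) where
  toFun : ℕ → Term F
  finite_dom : {x : ℕ | toFun x ≠ Term.var x}.Finite

/-- The domain of a substitution. -/
def Subst.Dom (σ : Subst F) : Set ℕ := {x : ℕ | σ.toFun x ≠ Term.var x}

/-- The variable range of a substitution: all variables occurring in the images
of domain variables. -/
def Subst.VRan (σ : Subst F) : Set ℕ := ⋃ x ∈ σ.Dom, (σ.toFun x).vars

/-- The instantiation preorder `σ ≤_E^X θ`: some substitution `λ` satisfies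
`λ(σ(x)) ≈_E θ(x)` for all `x ∈ X`. -/
def InstLE (E : Set (Term F × Term F)) (X : Set ℕ) (σ θ : Subst F) : Prop :=
  ∃ lam : Subst F, ∀ x ∈ X, EqE E ((σ.toFun x).subst lam.toFun) (θ.toFun x)

/-- The equivalence `σ ∼_E^X θ` induced by the instantiation preorder. -/
def InstEquiv (E : Set (Term F × Term F)) (X : Set ℕ) (σ θ : Subst F) : Prop :=
  InstLE E X σ θ ∧ InstLE E X θ σ

/-- The strict instantiation order `σ <_E^X θ`. -/
def InstLT (E : Set (Term F × Term F)) (X : Set ℕ) (σ θ : Subst F) : Prop :=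
  InstLE E X σ θ ∧ ¬ InstLE E X θ σ

/-- The set of variables occurring in a unification problem. -/
def VarsP (Γ : Set (Term F × Term F)) : Set ℕ :=
  ⋃ p ∈ Γ, (Prod.fst p).vars ∪ (Prod.snd p).vars

/-- `σ` is an `E`-unifier of the unification problem `Γ`. -/
def Unifier (E Γ : Set (Term F × Term F)) (σ : Subst F) : Prop :=
  ∀ p ∈ Γ, EqE E ((Prod.fst p).subst σ.toFun) ((Prod.snd p).subst σ.toFun)

/-- A unification problem is solvable if it has a unifier. -/
def Solvable (E Γ : Set (Term F × Term F)) : Prop := ∃ σ : Subst F, Unifier E Γ σ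

/-- `S` is a complete set of `E`-unifiers of `Γ` w.r.t. `≤_E^X`. -/
def CompleteSet (E Γ : Set (Term F × Term F)) (X : Set ℕ) (S : Set (Subst F)) : Prop :=
  (∀ σ ∈ S, Unifier E Γ σ) ∧ ∀ θ : Subst F, Unifier E Γ θ → ∃ σ ∈ S, InstLE E X σ θ

/-- `S` is a minimal complete set of `E`-unifiers of `Γ` w.r.t. `≤_E^X`:
complete, and no two distinct elements are comparable. -/
def MinimalComplete (E Γ : Set (Term F × Term F)) (X : Set ℕ) (S : Set (Subst F)) : Prop :=
  CompleteSet E Γ X S ∧ ∀ σ ∈ S, ∀ θ ∈ S, σ ≠ θ → ¬ InstLE E X σ θ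

/-- `Γ` has unification type unitary w.r.t. `≤_E^X`. -/
def TypeUnitary (E Γ : Set (Term F × Term F)) (X : Set ℕ) : Prop :=
  ∃ σ : Subst F, MinimalComplete E Γ X {σ}

/-- `Γ` has unification type finitary w.r.t. `≤_E^X`. -/
def TypeFinitary (E Γ : Set (Term F × Term F)) (X : Set ℕ) : Prop :=
  ∃ S : Set (Subst F), MinimalComplete E Γ X S ∧ S.Finite ∧ 1 < S.ncard

/-- `Γ` has unification type infinitary w.r.t. `≤_E^X`. -/
def TypeInfinitary (E Γ : Set (Term F × Term F)) (X : Set ℕ) : Prop :=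
  ∃ S : Set (Subst F), MinimalComplete E Γ X S ∧ S.Infinite

/-- `Γ` has unification type zero w.r.t. `≤_E^X`. -/
def TypeZero (E Γ : Set (Term F × Term F)) (X : Set ℕ) : Prop :=
  ¬ ∃ S : Set (Subst F), MinimalComplete E Γ X S

/-- `σ` is a `≤_E^X`-minimal `E`-unifier of `Γ`. -/
def MinUnifier (E Γ : Set (Term F × Term F)) (X : Set ℕ) (σ : Subst F) : Prop :=
  Unifier E Γ σ ∧ ∀ θ : Subst F, Unifier E Γ θ → InstLE E X θ σ → InstLE E X σ θ

/-- The set `C_E(Γ)` of unifiers all of whose range variables occur in the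
images of at least two distinct variables. -/
def CSet (E Γ : Set (Term F × Term F)) : Set (Subst F) :=
  {σ : Subst F | Unifier E Γ σ ∧
    ∀ y ∈ σ.VRan, ∃ x x' : ℕ, x ≠ x' ∧ y ∈ (σ.toFun x).vars ∩ (σ.toFun x').vars}

/-- `E` is Noetherian w.r.t. the unrestricted instantiation preorder: there is
no infinite strictly descending chain `σ₁ >_E^V σ₂ >_E^V ⋯`. -/
def Noetherian (E : Set (Term F × Term F)) : Prop :=
  ¬ ∃ f : ℕ → Subst F, ∀ n : ℕ, InstLT E Set.univ (f (n + 1)) (f n)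


/-- The unrestricted unification type of `E` (for elementary unification) is
infinitary: every solvable problem has a minimal complete set of unifiers
w.r.t. `≤_E^V`, and some solvable problem has an infinite minimal complete
set w.r.t. `≤_E^V` but no finite one. -/
def UnrestrictedTypeInfinitary {F : ℕ → Type} (E : Set (Term F × Term F)) : Prop :=
  (∀ Γ : Set (Term F × Term F), Γ.Finite → Solvable E Γ →
    ∃ S : Set (Subst F), MinimalComplete E Γ Set.univ S) ∧
  (∃ Γ : Set (Term F × Term F), Γ.Finite ∧ Solvable E Γ ∧
    (∃ S : Set (Subst F), S.Infinite ∧ MinimalComplete E Γ Set.univ S) ∧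
    ¬ ∃ S : Set (Subst F), S.Finite ∧ MinimalComplete E Γ Set.univ S)

/-- Signature with a single binary function symbol `f`. -/
inductive SigF : ℕ → Type
  | f : SigF 2

/-- Signature with two binary function symbols `m` and `p`. -/
inductive SigD : ℕ → Type
  | m : SigD 2
  | p : SigD 2

/-- The term `f(s,t)`. -/
def fT (s t : Term SigF) : Term SigF := Term.app 2 SigF.f ![s, t]

/-- The term `m(s,t)`. -/
def mT (s t : Term SigD) : Term SigD := Term.app 2 SigD.m ![s, t]

/-- The term `p(s,t)`. -/
def pT (s t : Term SigD) : Term SigD := Term.app 2 SigD.p ![s, t]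

/-- The theory `AC`: `f` is associative and commutative. -/
def ACTheory : Set (Term SigF × Term SigF) :=
  {(fT (.var 0) (fT (.var 1) (.var 2)), fT (fT (.var 0) (.var 1)) (.var 2)),
   (fT (.var 0) (.var 1), fT (.var 1) (.var 0))}

/-- The theory `D` of two-sided distributivity of `m` over `p`. -/
def DTheory : Set (Term SigD × Term SigD) :=
  {(mT (.var 2) (pT (.var 0) (.var 1)), pT (mT (.var 2) (.var 0)) (mT (.var 2) (.var 1))),
   (mT (pT (.var 0) (.var 1)) (.var 2), pT (mT (.var 0) (.var 2)) (mT (.var 1) (.var 2)))}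

section Evaluation

/-- The value of a term in the algebra `op` under the assignment `v`. -/
def Term.eval {α : Type} (op : ∀ n, F n → (Fin n → α) → α) (v : ℕ → α) : Term F → α
  | .var x => v x
  | .app n f ts => op n f (fun i => (ts i).eval op v)

theorem Term.eval_subst {α : Type} (op : ∀ n, F n → (Fin n → α) → α) (v : ℕ → α)
    (lam : ℕ → Term F) (t : Term F) :
    (t.subst lam).eval op v = t.eval op (fun x => (lam x).eval op v) := by
  induction t with
  | var x => rfl
  | app n f ts ih => simp only [Term.subst, Term.eval, ih]

/-- Soundness: identities valid in an algebra hold for all `E`-equal terms. -/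
theorem EqE.eval_eq {α : Type} {E : Set (Term F × Term F)} {op : ∀ n, F n → (Fin n → α) → α}
    (hE : ∀ p ∈ E, ∀ v : ℕ → α, p.1.eval op v = p.2.eval op v) {s t : Term F} (h : EqE E s t)
    (v : ℕ → α) : s.eval op v = t.eval op v := by
  induction h with
  | ax σ hm => rw [Term.eval_subst, Term.eval_subst]; exact hE _ hm _
  | refl t => rfl
  | symm _ ih => exact ih.symm
  | trans _ _ ih₁ ih₂ => exact ih₁.trans ih₂
  | congr f _ ih => simp only [Term.eval, ih]

end Evaluation

section Substitution

theorem Term.eval_congr {α : Type} {op : ∀ n, F n → (Fin n → α) → α} {v w : ℕ → α} {t : Term F}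
    (h : ∀ x ∈ t.vars, v x = w x) : t.eval op v = t.eval op w := by
  induction t with
  | var x => exact h x rfl
  | app n f ts ih =>
    simp only [Term.eval]
    congr 1
    funext i
    exact ih i fun x hx => h x (Set.mem_iUnion.2 ⟨i, hx⟩)

theorem Term.subst_subst (σ τ : ℕ → Term F) (t : Term F) :
    (t.subst σ).subst τ = t.subst (fun x => (σ x).subst τ) := by
  induction t with
  | var x => rfl
  | app n f ts ih => simp only [Term.subst, ih]

theorem Term.subst_congr {σ τ : ℕ → Term F} {t : Term F} (h : ∀ x ∈ t.vars, σ x = τ x) :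
    t.subst σ = t.subst τ := by
  induction t with
  | var x => exact h x rfl
  | app n f ts ih =>
    simp only [Term.subst]
    congr 1
    funext i
    exact ih i fun x hx => h x (Set.mem_iUnion.2 ⟨i, hx⟩)

theorem Term.subst_var (t : Term F) : t.subst Term.var = t := by
  induction t with
  | var x => rfl
  | app n f ts ih => simp only [Term.subst, ih]

theorem Term.mem_vars_subst {σ : ℕ → Term F} {t : Term F} {y : ℕ} :
    y ∈ (t.subst σ).vars ↔ ∃ x ∈ t.vars, y ∈ (σ x).vars := by
  induction t with
  | var x => simp [Term.subst, Term.vars]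
  | app n f ts ih =>
    simp only [Term.subst, Term.vars, Set.mem_iUnion, ih]
    constructor
    · rintro ⟨i, x, hx, hy⟩
      exact ⟨x, ⟨i, hx⟩, hy⟩
    · rintro ⟨x, ⟨i, hx⟩, hy⟩
      exact ⟨i, x, hx, hy⟩

variable {E : Set (Term F × Term F)}

theorem EqE.subst {s t : Term F} (h : EqE E s t) (τ : ℕ → Term F) :
    EqE E (s.subst τ) (t.subst τ) := by
  induction h with
  | ax σ hm => rw [Term.subst_subst, Term.subst_subst]; exact EqE.ax _ hm
  | refl t => exact EqE.refl _
  | symm _ ih => exact ih.symm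
  | trans _ _ ih₁ ih₂ => exact ih₁.trans ih₂
  | congr f _ ih => exact EqE.congr f ih

theorem EqE.subst_congr {σ τ : ℕ → Term F} (h : ∀ x, EqE E (σ x) (τ x)) (t : Term F) :
    EqE E (t.subst σ) (t.subst τ) := by
  induction t with
  | var x => exact h x
  | app n f ts ih => exact EqE.congr f ih

theorem EqE.vars_eq (hE : Regular E) {s t : Term F} (h : EqE E s t) : s.vars = t.vars := by
  have hsub : ∀ (r : Term F) (σ : ℕ → Term F), (r.subst σ).vars = ⋃ x ∈ r.vars, (σ x).vars := by
    intro r σ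
    ext y
    simp [Term.mem_vars_subst]
  induction h with
  | ax σ hm => rw [hsub, hsub, hE _ hm]
  | refl t => rfl
  | symm _ ih => exact ih.symm
  | trans _ _ ih₁ ih₂ => exact ih₁.trans ih₂
  | congr f _ ih => simp only [Term.vars, ih]

/-- The identity substitution. -/
def Subst.id : Subst F := ⟨Term.var, by simp⟩

/-- The composition of substitutions, applying `σ` first. -/
def Subst.comp (σ τ : Subst F) : Subst F where
  toFun x := (σ.toFun x).subst τ.toFun
  finite_dom := by
    refine (σ.finite_dom.union τ.finite_dom).subset fun x hx => ?_
    by_contra h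
    simp only [Set.mem_union, Set.mem_ofPred_eq, not_or, not_not] at h
    exact hx (by rw [h.1]; exact h.2)

theorem InstLE.refl (X : Set ℕ) (σ : Subst F) : InstLE E X σ σ :=
  ⟨Subst.id, fun x _ => by
    change EqE E ((σ.toFun x).subst Term.var) _
    rw [Term.subst_var]
    exact EqE.refl _⟩

theorem InstLE.trans {X : Set ℕ} {σ τ θ : Subst F} (h₁ : InstLE E X σ τ) (h₂ : InstLE E X τ θ) :
    InstLE E X σ θ := by
  obtain ⟨l₁, h₁⟩ := h₁
  obtain ⟨l₂, h₂⟩ := h₂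
  refine ⟨l₁.comp l₂, fun x hx => ?_⟩
  have h := (h₁ x hx).subst l₂.toFun
  rw [Term.subst_subst] at h
  exact h.trans (h₂ x hx)

theorem Unifier.of_instLE {Γ : Set (Term F × Term F)} {σ θ : Subst F} (hσ : Unifier E Γ σ)
    (h : InstLE E Set.univ σ θ) : Unifier E Γ θ := by
  obtain ⟨l, hl⟩ := h
  intro p hp
  have key : ∀ t : Term F, EqE E ((t.subst σ.toFun).subst l.toFun) (t.subst θ.toFun) := fun t => by
    rw [Term.subst_subst]
    exact EqE.subst_congr (fun x => hl x trivial) t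
  exact (key _).symm.trans (((hσ p hp).subst _).trans (key _))

theorem exists_minimalComplete (hwf : WellFounded (InstLT E Set.univ))
    (Γ : Set (Term F × Term F)) : ∃ S, MinimalComplete E Γ Set.univ S := by
  let r : Setoid (Subst F) :=
    ⟨InstEquiv E Set.univ, fun σ => ⟨.refl _ σ, .refl _ σ⟩, fun h => ⟨h.2, h.1⟩,
      fun h₁ h₂ => ⟨h₁.1.trans h₂.1, h₂.2.trans h₁.2⟩⟩
  have hrep : ∀ σ : Subst F, InstEquiv E Set.univ (Quotient.mk r σ).out σ :=
    fun σ => Quotient.exact (Quotient.out_eq (Quotient.mk r σ))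
  refine ⟨{σ | MinUnifier E Γ Set.univ σ ∧ (Quotient.mk r σ).out = σ},
    ⟨fun σ hσ => hσ.1.1, fun θ hθ => ?_⟩, ?_⟩
  · obtain ⟨σ, ⟨hσu, hσθ⟩, hmin⟩ :=
      hwf.has_min {σ | Unifier E Γ σ ∧ InstLE E Set.univ σ θ} ⟨θ, hθ, .refl _ θ⟩
    obtain ⟨h₁, h₂⟩ := hrep σ
    refine ⟨(Quotient.mk r σ).out, ⟨⟨hσu.of_instLE h₂, fun τ hτ hle => h₁.trans ?_⟩, ?_⟩,
      h₁.trans hσθ⟩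
    · by_contra hcon
      exact hmin τ ⟨hτ, (hle.trans h₁).trans hσθ⟩ ⟨hle.trans h₁, hcon⟩
    · rw [Quotient.out_eq]
  · intro σ hσ θ hθ hne hle
    have h : InstEquiv E Set.univ σ θ := ⟨hle, hθ.1.2 σ hσ.1.1 hle⟩
    apply hne
    rw [← hσ.2, ← hθ.2, Quotient.sound (s := r) h]

theorem unrestrictedTypeInfinitary_of_wellFounded (hwf : WellFounded (InstLT E Set.univ))
    {Γ : Set (Term F × Term F)} (hΓ : Γ.Finite) (hs : Solvable E Γ)
    (hinf : ∀ S : Set (Subst F), S.Finite → ¬ CompleteSet E Γ Set.univ S) :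
    UnrestrictedTypeInfinitary E := by
  refine ⟨fun Γ _ _ => exists_minimalComplete hwf Γ, Γ, hΓ, hs, ?_, ?_⟩
  · obtain ⟨S, hS⟩ := exists_minimalComplete hwf Γ
    exact ⟨S, fun hfin => hinf S hfin hS.1, hS⟩
  · rintro ⟨S, hfin, hS⟩
    exact hinf S hfin hS.1

end Substitution

section WellFoundedness

variable {E : Set (Term F × Term F)}

/-- The variables that occur in some image of `σ`. -/
def Subst.occ (σ : Subst F) : Set ℕ := {y | ∃ x, y ∈ (σ.toFun x).vars}

theorem Subst.finite_compl_occ (σ : Subst F) : (σ.occᶜ).Finite := by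
  refine σ.finite_dom.subset fun y hy hyv => hy ⟨y, ?_⟩
  rw [hyv]
  rfl

/-- An instantiation that renames every occurring variable does not decrease the number of
variables missing from the images, and is reversible if it preserves this number. -/
theorem ncard_compl_occ_of_renaming (hE : Regular E) {σ θ lam : Subst F}
    (hl : ∀ x, EqE E ((σ.toFun x).subst lam.toFun) (θ.toFun x))
    (hv : ∀ y ∈ σ.occ, ∃ z, lam.toFun y = .var z) :
    (σ.occᶜ).ncard ≤ (θ.occᶜ).ncard ∧
      ((σ.occᶜ).ncard = (θ.occᶜ).ncard → InstLE E Set.univ θ σ) := by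
  classical
  choose! ρ hρ using hv
  have hρ_out : ∀ y ∈ σ.occ, y ∉ lam.Dom → ρ y = y := by
    intro y hy hd
    have h : lam.toFun y = .var y := not_not.1 hd
    rw [hρ y hy] at h
    injection h
  have himg : ρ '' σ.occ = θ.occ := by
    ext z
    constructor
    · rintro ⟨y, ⟨x, hyx⟩, rfl⟩
      refine ⟨x, ?_⟩
      rw [← (hl x).vars_eq hE, Term.mem_vars_subst]
      exact ⟨y, hyx, by rw [hρ y ⟨x, hyx⟩]; rfl⟩
    · rintro ⟨x, hz⟩
      rw [← (hl x).vars_eq hE, Term.mem_vars_subst] at hz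
      obtain ⟨y, hyx, hz⟩ := hz
      rw [hρ y ⟨x, hyx⟩] at hz
      exact ⟨y, ⟨x, hyx⟩, (Set.mem_singleton_iff.1 hz).symm⟩
  set W : Set ℕ := lam.Dom ∪ ρ '' lam.Dom ∪ σ.occᶜ ∪ θ.occᶜ with hW
  have hWf : W.Finite :=
    (((lam.finite_dom).union (lam.finite_dom.image ρ)).union σ.finite_compl_occ).union
      θ.finite_compl_occ
  have hρ_outW : ∀ y ∈ σ.occ, y ∉ W → ρ y = y := fun y hy hyW =>
    hρ_out y hy fun hd => hyW (Or.inl (Or.inl (Or.inl hd)))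
  have hρW : ∀ y ∈ σ.occ, y ∈ W → ρ y ∈ W := by
    intro y hy hyW
    by_cases hd : y ∈ lam.Dom
    · exact Or.inl (Or.inl (Or.inr ⟨y, hd, rfl⟩))
    · rwa [hρ_out y hy hd]
  have hsurj : ρ '' (W \ σ.occᶜ) = W \ θ.occᶜ := by
    ext z
    constructor
    · rintro ⟨y, ⟨hyW, hy⟩, rfl⟩
      have hy : y ∈ σ.occ := not_not.1 hy
      exact ⟨hρW y hy hyW, not_not.2 (himg ▸ ⟨y, hy, rfl⟩)⟩
    · rintro ⟨hzW, hz⟩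
      have hz : z ∈ θ.occ := not_not.1 hz
      rw [← himg] at hz
      obtain ⟨y, hy, rfl⟩ := hz
      by_cases hyW : y ∈ W
      · exact ⟨y, ⟨hyW, not_not.2 hy⟩, rfl⟩
      · rw [hρ_outW y hy hyW] at hzW
        exact absurd hzW hyW
  have hσW : σ.occᶜ ⊆ W := fun y hy => Or.inl (Or.inr hy)
  have hθW : θ.occᶜ ⊆ W := fun y hy => Or.inr hy
  have hcσ := Set.ncard_sdiff_add_ncard_of_subset hσW hWf
  have hcθ := Set.ncard_sdiff_add_ncard_of_subset hθW hWf
  have hle := Set.ncard_image_le (f := ρ) (hWf.sdiff (t := σ.occᶜ))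
  rw [hsurj] at hle
  refine ⟨by omega, fun heq => ?_⟩
  have hinjW : Set.InjOn ρ (W \ σ.occᶜ) :=
    Set.injOn_of_ncard_image_eq (by rw [hsurj]; omega) hWf.sdiff
  have hinj : Set.InjOn ρ σ.occ := by
    intro y hy z hz hyz
    by_cases hyW : y ∈ W <;> by_cases hzW : z ∈ W
    · exact hinjW ⟨hyW, not_not.2 hy⟩ ⟨hzW, not_not.2 hz⟩ hyz
    · have := hρW y hy hyW
      rw [hyz, hρ_outW z hz hzW] at this
      exact absurd this hzW
    · have := hρW z hz hzW
      rw [← hyz, hρ_outW y hy hyW] at this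
      exact absurd this hyW
    · rwa [hρ_outW y hy hyW, hρ_outW z hz hzW] at hyz
  let τ : ℕ → ℕ := fun z => if z ∈ θ.occ then Function.invFunOn ρ σ.occ z else z
  have hτ : ∀ y ∈ σ.occ, τ (ρ y) = y := by
    intro y hy
    have h : ρ y ∈ θ.occ := himg ▸ ⟨y, hy, rfl⟩
    simp only [τ, if_pos h]
    exact hinj.leftInvOn_invFunOn hy
  refine ⟨⟨fun z => .var (τ z), hWf.subset fun z hz => ?_⟩, fun x _ => ?_⟩
  · by_contra hzW
    apply hz
    have hzθ : z ∈ θ.occ := by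
      by_contra h
      exact hzW (hθW h)
    rw [← himg] at hzθ
    obtain ⟨y, hy, rfl⟩ := hzθ
    have hyW : y ∉ W := fun h => hzW (hρW y hy h)
    change Term.var (τ (ρ y)) = Term.var (ρ y)
    rw [hτ y hy, hρ_outW y hy hyW]
  · refine ((hl x).symm.subst _).trans ?_
    rw [Term.subst_subst, Term.subst_congr (τ := Term.var), Term.subst_var]
    · exact EqE.refl _
    · intro y hy
      rw [hρ y ⟨x, hy⟩]
      simp only [Term.subst, hτ y ⟨x, hy⟩]

/-- Natural-number operations that are strictly monotone in each argument and increasing on values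
that are at least `2`. -/
structure IsWeight (op : ∀ n, F n → (Fin n → ℕ) → ℕ) : Prop where
  mono : ∀ {n} (f : F n) {a b : Fin n → ℕ}, (∀ i, 2 ≤ a i) → (∀ i, a i ≤ b i) → op n f a ≤ op n f b
  strict : ∀ {n} (f : F n) {a b : Fin n → ℕ}, (∀ i, 2 ≤ a i) → (∀ i, a i ≤ b i) →
    op n f a = op n f b → ∀ i, a i = b i
  two_lt : ∀ {n} (f : F n) {a : Fin n → ℕ}, (∀ i, 2 ≤ a i) → 2 < op n f a

/-- The weight of a term: its value when every variable is assigned `2`. -/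
def Term.weight (op : ∀ n, F n → (Fin n → ℕ) → ℕ) (t : Term F) : ℕ := t.eval op (fun _ => 2)

variable {op : ∀ n, F n → (Fin n → ℕ) → ℕ}

theorem IsWeight.two_le (hop : IsWeight op) (t : Term F) : 2 ≤ t.weight op := by
  induction t with
  | var x => exact le_rfl
  | app n f ts ih => exact (hop.two_lt f ih).le

theorem IsWeight.eq_var (hop : IsWeight op) {t : Term F} (h : t.weight op = 2) :
    ∃ x, t = .var x := by
  cases t with
  | var x => exact ⟨x, rfl⟩
  | app n f ts => exact absurd h (hop.two_lt f fun i => hop.two_le (ts i)).ne'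

theorem IsWeight.le_subst (hop : IsWeight op) (lam : ℕ → Term F) (t : Term F) :
    t.weight op ≤ (t.subst lam).weight op := by
  induction t with
  | var x => exact hop.two_le _
  | app n f ts ih => exact hop.mono f (fun i => hop.two_le (ts i)) ih

theorem IsWeight.weight_eq_two (hop : IsWeight op) {lam : ℕ → Term F} {t : Term F}
    (h : t.weight op = (t.subst lam).weight op) : ∀ x ∈ t.vars, (lam x).weight op = 2 := by
  induction t with
  | var x =>
    rintro y rfl
    exact h.symm
  | app n f ts ih =>
    intro x hx
    obtain ⟨i, hi⟩ := Set.mem_iUnion.1 hx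
    exact ih i (hop.strict f (fun i => hop.two_le (ts i)) (fun i => hop.le_subst lam (ts i)) h i)
      x hi

/-- The total weight of the images of `σ` in excess of the weight of variables. -/
noncomputable def Subst.excess (op : ∀ n, F n → (Fin n → ℕ) → ℕ) (σ : Subst F) : ℕ :=
  ∑ x ∈ σ.finite_dom.toFinset, ((σ.toFun x).weight op - 2)

theorem Subst.excess_eq_sum (σ : Subst F) {A : Finset ℕ} (hA : σ.finite_dom.toFinset ⊆ A) :
    σ.excess op = ∑ x ∈ A, ((σ.toFun x).weight op - 2) := by
  refine Finset.sum_subset hA fun x _ hx => ?_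
  have h : σ.toFun x = .var x := by simpa using hx
  rw [h]
  rfl

/-- A regular theory with an invariant weight is Noetherian. -/
theorem wellFounded_instLT (hE : Regular E) (hop : IsWeight op)
    (hEop : ∀ p ∈ E, ∀ v : ℕ → ℕ, p.1.eval op v = p.2.eval op v) :
    WellFounded (InstLT E Set.univ) := by
  have hlex : WellFounded (InvImage (Prod.Lex (· < ·) (· < ·))
      fun σ : Subst F => (σ.excess op, (σ.occᶜ).ncard)) :=
    InvImage.wf _ (WellFounded.prod_lex wellFounded_lt wellFounded_lt)
  refine Subrelation.wf ?_ hlex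
  rintro σ θ ⟨⟨lam, hl⟩, hnot⟩
  replace hl : ∀ x, EqE E ((σ.toFun x).subst lam.toFun) (θ.toFun x) := fun x => hl x trivial
  have hw : ∀ x, ((σ.toFun x).subst lam.toFun).weight op = (θ.toFun x).weight op :=
    fun x => (hl x).eval_eq hEop _
  have hle : ∀ x, (σ.toFun x).weight op ≤ (θ.toFun x).weight op :=
    fun x => (hop.le_subst _ _).trans (hw x).le
  set A := σ.finite_dom.toFinset ∪ θ.finite_dom.toFinset with hA
  have hσA := σ.excess_eq_sum (op := op) (A := A) Finset.subset_union_left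
  have hθA := θ.excess_eq_sum (op := op) (A := A) Finset.subset_union_right
  have hterm : ∀ x ∈ A, (σ.toFun x).weight op - 2 ≤ (θ.toFun x).weight op - 2 :=
    fun x _ => Nat.sub_le_sub_right (hle x) 2
  rcases (Finset.sum_le_sum hterm).lt_or_eq with hlt | heq
  · exact Prod.Lex.left _ _ (by rwa [hσA, hθA])
  · have hexc : σ.excess op = θ.excess op := by rw [hσA, hθA, heq]
    have hweq : ∀ x, (σ.toFun x).weight op = (θ.toFun x).weight op := by
      intro x
      by_cases hx : x ∈ A
      · have h := (Finset.sum_eq_sum_iff_of_le hterm).1 heq x hx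
        have h₁ := hop.two_le (σ.toFun x)
        have h₂ := hop.two_le (θ.toFun x)
        omega
      · simp only [hA, Finset.mem_union, Set.Finite.mem_toFinset, Set.mem_ofPred_eq, not_or,
          not_not] at hx
        rw [hx.1, hx.2]
    have hv : ∀ y ∈ σ.occ, ∃ z, lam.toFun y = .var z := by
      rintro y ⟨x, hy⟩
      exact hop.eq_var (hop.weight_eq_two ((hweq x).trans (hw x).symm) y hy)
    obtain ⟨h₁, h₂⟩ := ncard_compl_occ_of_renaming hE hl hv
    have h₃ : (σ.occᶜ).ncard < (θ.occᶜ).ncard := lt_of_le_of_ne h₁ fun h => hnot (h₂ h)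
    simp only [InvImage, hexc]
    exact Prod.Lex.right _ h₃

end WellFoundedness

section AC

/-- The weight operations for `AC`: the symbol `f` adds. -/
def addOp {α : Type} [Add α] : ∀ n, SigF n → (Fin n → α) → α
  | _, .f, a => a 0 + a 1

theorem addOp_valid {α : Type} [AddCommSemigroup α] :
    ∀ p ∈ ACTheory, ∀ v : ℕ → α, p.1.eval addOp v = p.2.eval addOp v := by
  rintro p (rfl | rfl) v
  · simp [fT, Term.eval, addOp, add_assoc]
  · simp [fT, Term.eval, addOp, add_comm]

theorem isWeight_addOp : IsWeight (addOp (α := ℕ)) where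
  mono := by
    rintro _ ⟨⟩ a b ha h
    exact add_le_add (h 0) (h 1)
  strict := by
    rintro _ ⟨⟩ a b ha h heq
    have h₀ := h 0
    have h₁ := h 1
    simp only [addOp] at heq
    refine Fin.forall_fin_two.2 ⟨?_, ?_⟩ <;> omega
  two_lt := by
    rintro _ ⟨⟩ a ha
    have h₀ := ha 0
    have h₁ := ha 1
    simp only [addOp]
    omega

theorem regular_ACTheory : Regular ACTheory := by
  rintro p (rfl | rfl)
  · ext; simp [fT, Term.vars, Fin.exists_fin_two, or_assoc]
  · ext; simp [fT, Term.vars, Fin.exists_fin_two, or_comm]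

/-- The multiset of variable occurrences of a term. -/
def Term.occs (t : Term SigF) : Multiset ℕ := t.eval addOp (fun x => {x})

theorem occs_fT (s t : Term SigF) : (fT s t).occs = s.occs + t.occs := rfl

theorem occs_var (x : ℕ) : (Term.var x : Term SigF).occs = {x} := rfl

theorem occs_subst (t : Term SigF) (lam : ℕ → Term SigF) :
    (t.subst lam).occs = t.occs.bind fun x => (lam x).occs := by
  induction t with
  | var x => simp [Term.subst, occs_var]
  | app n g ts ih =>
    cases g
    change ((ts 0).subst lam).occs + ((ts 1).subst lam).occs =
      ((ts 0).occs + (ts 1).occs).bind _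
    rw [ih, ih, Multiset.add_bind]

theorem mem_occs {t : Term SigF} {x : ℕ} : x ∈ t.occs ↔ x ∈ t.vars := by
  induction t with
  | var y => simp [Term.vars, occs_var]
  | app n g ts ih =>
    cases g
    change x ∈ (ts 0).occs + (ts 1).occs ↔ _
    simp only [Multiset.mem_add, ih, Term.vars, Set.mem_iUnion, Fin.exists_fin_two]

theorem EqE.occs_eq {s t : Term SigF} (h : EqE ACTheory s t) : s.occs = t.occs :=
  h.eval_eq addOp_valid _

theorem fT_subst (s t : Term SigF) (σ : ℕ → Term SigF) :
    (fT s t).subst σ = fT (s.subst σ) (t.subst σ) := by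
  simp only [fT, Term.subst]
  congr 1
  funext i
  fin_cases i <;> rfl

theorem EqE.fT_congr {s s' t t' : Term SigF} (h₁ : EqE ACTheory s s') (h₂ : EqE ACTheory t t') :
    EqE ACTheory (fT s t) (fT s' t') :=
  EqE.congr SigF.f (Fin.forall_fin_two.2 ⟨h₁, h₂⟩)

theorem EqE.fT_assoc (s t u : Term SigF) : EqE ACTheory (fT (fT s t) u) (fT s (fT t u)) := by
  have h := EqE.ax (E := ACTheory) (fun n => if n = 0 then s else if n = 1 then t else u)
    (Or.inl rfl)
  simp only [fT_subst, Term.subst] at h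
  exact h.symm

theorem EqE.fT_comm (s t : Term SigF) : EqE ACTheory (fT s t) (fT t s) := by
  have h := EqE.ax (E := ACTheory) (fun n => if n = 0 then s else t) (Or.inr rfl)
  simp only [fT_subst, Term.subst] at h
  exact h

/-- Equality modulo `AC` as a setoid. -/
def acSetoid : Setoid (Term SigF) := ⟨EqE ACTheory, EqE.refl, EqE.symm, EqE.trans⟩

/-- The operation of the free commutative semigroup. -/
def acAdd : Quotient acSetoid → Quotient acSetoid → Quotient acSetoid :=
  Quotient.map₂ fT fun _ _ h₁ _ _ h₂ => EqE.fT_congr h₁ h₂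

instance : Std.Associative acAdd where
  assoc a b c := Quotient.inductionOn₃ a b c fun s t u => Quotient.sound (EqE.fT_assoc s t u)

instance : Std.Commutative acAdd where
  comm a b := Quotient.inductionOn₂ a b fun s t => Quotient.sound (EqE.fT_comm s t)

/-- The problem `3x = y + z`, written additively. -/
def acProblem : Set (Term SigF × Term SigF) :=
  {(fT (.var 0) (fT (.var 0) (.var 0)), fT (.var 1) (.var 2))}

/-- The substitution `x ↦ x + y + z + w`, `y ↦ 3x + 2y + z`, `z ↦ y + 2z + 3w`, where `w` is the
variable with index `N`. -/
def acSol (N : ℕ) : Subst SigF where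
  toFun n :=
    if n = 0 then fT (.var 0) (fT (.var 1) (fT (.var 2) (.var N)))
    else if n = 1 then
      fT (.var 0) (fT (.var 0) (fT (.var 0) (fT (.var 1) (fT (.var 1) (.var 2)))))
    else if n = 2 then
      fT (.var 1) (fT (.var 2) (fT (.var 2) (fT (.var N) (fT (.var N) (.var N)))))
    else .var n
  finite_dom := by
    refine (Set.finite_Iio 3).subset fun n hn => ?_
    by_contra h
    have h3 : ¬ n < 3 := h
    apply hn
    rw [if_neg (by omega), if_neg (by omega), if_neg (by omega)]

theorem unifier_acSol (N : ℕ) : Unifier ACTheory acProblem (acSol N) := by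
  rintro p rfl
  have key : ∀ a b c d : Quotient acSetoid,
      acAdd (acAdd a (acAdd b (acAdd c d)))
        (acAdd (acAdd a (acAdd b (acAdd c d))) (acAdd a (acAdd b (acAdd c d)))) =
      acAdd (acAdd a (acAdd a (acAdd a (acAdd b (acAdd b c)))))
        (acAdd b (acAdd c (acAdd c (acAdd d (acAdd d d))))) := by
    intro a b c d
    ac_rfl
  have h := key (Quotient.mk _ (.var 0)) (Quotient.mk _ (.var 1)) (Quotient.mk _ (.var 2))
    (Quotient.mk _ (.var N))
  simp only [fT_subst, Term.subst]
  exact Quotient.exact h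

/-- If the occurrences in `t` are among those in `s`, and `a` occurs once in the instance of `s`,
coming from the variable `v`, then `a` occurs in the instance of `t` as often as `v` in `t`. -/
theorem count_occs_subst {s t : Term SigF} {lam : ℕ → Term SigF} {a v : ℕ}
    (hst : ∀ x ∈ t.occs, x ∈ s.occs) (ha : (s.subst lam).occs.count a = 1) (hv : v ∈ s.occs)
    (hav : a ∈ (lam v).occs) : (t.subst lam).occs.count a = t.occs.count v := by
  classical
  obtain ⟨M, hM⟩ := Multiset.exists_cons_of_mem hv
  have hpos : 0 < (lam v).occs.count a := Multiset.count_pos.2 hav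
  rw [occs_subst, hM, Multiset.cons_bind, Multiset.count_add, Multiset.count_bind] at ha
  have hone : (lam v).occs.count a = 1 := by omega
  have hzero : ∀ w ∈ M, (lam w).occs.count a = 0 := by
    have hsum : (M.map fun w => (lam w).occs.count a).sum = 0 := by omega
    intro w hw
    exact Multiset.sum_eq_zero_iff.1 hsum _ (Multiset.mem_map_of_mem _ hw)
  have hcount : ∀ w ∈ t.occs, (lam w).occs.count a = if v = w then 1 else 0 := by
    intro w hw
    have hws := hst w hw
    rw [hM, Multiset.mem_cons] at hws
    split_ifs with h
    · rw [← h, hone]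
    · exact hzero w (hws.resolve_left fun h' => h h'.symm)
  rw [occs_subst, Multiset.count_bind, Multiset.map_congr rfl hcount]
  induction t.occs using Multiset.induction_on with
  | empty => simp
  | cons w M ih => rw [Multiset.map_cons, Multiset.sum_cons, ih, Multiset.count_cons, add_comm]

theorem not_completeSet_acProblem (S : Set (Subst SigF)) (hS : S.Finite) :
    ¬ CompleteSet ACTheory acProblem Set.univ S := by
  rintro ⟨hu, hc⟩
  obtain ⟨N₀, hN₀⟩ : ∃ N, ∀ σ ∈ S, ∀ y ∈ (σ.toFun 0).vars, y < N := by
    have hfin : (⋃ σ ∈ S, (σ.toFun 0).vars).Finite := by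
      refine hS.biUnion fun σ _ => ?_
      refine (σ.toFun 0).occs.toFinset.finite_toSet.subset fun y hy => ?_
      simpa using mem_occs.2 hy
    obtain ⟨b, hb⟩ := hfin.bddAbove
    exact ⟨b + 1, fun σ hσ y hy => Nat.lt_succ_of_le (hb (Set.mem_biUnion hσ hy))⟩
  obtain ⟨N₁, hN₁⟩ : ∃ N, ∀ σ ∈ S, ∀ x, N ≤ x → σ.toFun x = .var x := by
    obtain ⟨b, hb⟩ := (hS.biUnion fun σ _ => σ.finite_dom).bddAbove
    refine ⟨b + 1, fun σ hσ x hx => ?_⟩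
    by_contra h
    have := hb (Set.mem_biUnion hσ h)
    omega
  obtain ⟨N, h3N, hN₀N, hN₁N⟩ : ∃ N, 3 ≤ N ∧ N₀ ≤ N ∧ N₁ ≤ N :=
    ⟨3 + N₀ + N₁, by omega, by omega, by omega⟩
  obtain ⟨σ, hσ, lam, hl⟩ := hc _ (unifier_acSol N)
  have ho : ∀ x, ((σ.toFun x).subst lam.toFun).occs = ((acSol N).toFun x).occs :=
    fun x => (hl x trivial).occs_eq
  have ho₀ : ((acSol N).toFun 0).occs = {0} + ({1} + ({2} + {N})) := rfl
  have ho₁ : ((acSol N).toFun 1).occs = {0} + ({0} + ({0} + ({1} + ({1} + {2})))) := rfl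
  have ho₃ : ∀ x, 3 ≤ x → ((acSol N).toFun x).occs = {x} := by
    intro x hx
    have h : (acSol N).toFun x = .var x := by
      simp only [acSol]
      rw [if_neg (by omega), if_neg (by omega), if_neg (by omega)]
    rw [h, occs_var]
  have hmem : ∀ {x y v : ℕ}, v ∈ (σ.toFun x).occs → y ∈ (lam.toFun v).occs →
      y ∈ ((acSol N).toFun x).occs := by
    intro x y v hv hy
    rw [← ho, occs_subst]
    exact Multiset.mem_bind.2 ⟨v, hv, hy⟩
  let special : ℕ → Prop := fun j => j < 3 ∨ j = N
  have hspecial : ∀ j, j ∈ ((acSol N).toFun 0).occs ↔ special j := by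
    intro j
    simp only [ho₀, Multiset.mem_add, Multiset.mem_singleton, special]
    omega
  let src : ℕ → ℕ := fun j => if special j then 0 else j
  have hsrc : ∀ j, j ∈ ((acSol N).toFun (src j)).occs := by
    intro j
    by_cases hj : special j
    · simp only [src, if_pos hj]
      exact (hspecial j).2 hj
    · simp only [src, if_neg hj]
      rw [ho₃ j (by simp only [special] at hj; omega)]
      exact Multiset.mem_singleton_self j
  have hex : ∀ j, ∃ v, v ∈ (σ.toFun (src j)).occs ∧ j ∈ (lam.toFun v).occs := by
    intro j
    have h := hsrc j
    rw [← ho, occs_subst] at h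
    exact Multiset.mem_bind.1 h
  choose g hgσ hgl using hex
  have hmaps : ∀ j ∈ Finset.range (N + 1), g j ∈ Finset.range N := by
    intro j hj
    rw [Finset.mem_range] at hj ⊢
    have hgj := hgσ j
    by_cases hs : special j
    · simp only [src, if_pos hs] at hgj
      exact (hN₀ σ hσ _ (mem_occs.1 hgj)).trans_le hN₀N
    · simp only [src, if_neg hs] at hgj
      by_contra hge
      have hlam := ho (g j)
      rw [hN₁ σ hσ _ (by omega), ho₃ _ (by omega)] at hlam
      change (lam.toFun (g j)).occs = {g j} at hlam
      have h := hmem hgj (hlam ▸ Multiset.mem_singleton_self (g j))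
      simp only [special] at hs
      rw [ho₃ j (by omega), Multiset.mem_singleton] at h
      omega
  obtain ⟨i, hi, j, hj, hij, hgij⟩ :=
    Finset.exists_ne_map_eq_of_card_lt_of_maps_to (by simp) hmaps
  have hordinary : ∀ i j, ¬ special i → g i = g j → i = j := by
    intro i j hs h
    have hgi := hgσ i
    simp only [src, if_neg hs] at hgi
    have h' := hmem hgi (h ▸ hgl j)
    simp only [special] at hs
    rw [ho₃ i (by omega), Multiset.mem_singleton] at h'
    exact h'.symm
  by_cases hsi : special i
  · by_cases hsj : special j
    · have hsub : ∀ x ∈ (σ.toFun 1).occs, x ∈ (σ.toFun 0).occs := by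
        intro x hx
        have h := (hu σ hσ _ rfl).occs_eq
        simp only [fT_subst, occs_fT, Term.subst] at h
        have hx' : x ∈ (σ.toFun 1).occs + (σ.toFun 2).occs :=
          Multiset.mem_add.2 (Or.inl hx)
        simpa [← h] using hx'
      have hcount : ∀ a, special a →
          ((acSol N).toFun 1).occs.count a = (σ.toFun 1).occs.count (g a) := by
        intro a ha
        have hga := hgσ a
        simp only [src, if_pos ha] at hga
        rw [← ho]
        refine count_occs_subst hsub ?_ hga (hgl a)
        rw [ho, ho₀]
        simp only [Multiset.count_add, Multiset.count_singleton]
        simp only [special] at ha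
        split_ifs <;> omega
      have h := hcount i hsi
      rw [hgij, ← hcount j hsj] at h
      rw [ho₁] at h
      simp only [Multiset.count_add, Multiset.count_singleton] at h
      simp only [special] at hsi hsj
      split_ifs at h <;> omega
    · exact hij (hordinary j i hsj hgij.symm).symm
  · exact hij (hordinary i j hsi hgij)

end AC

section Distributivity

theorem mT_subst (s t : Term SigD) (σ : ℕ → Term SigD) :
    (mT s t).subst σ = mT (s.subst σ) (t.subst σ) := by
  simp only [mT, Term.subst]
  congr 1
  funext i
  fin_cases i <;> rfl

theorem pT_subst (s t : Term SigD) (σ : ℕ → Term SigD) :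
    (pT s t).subst σ = pT (s.subst σ) (t.subst σ) := by
  simp only [pT, Term.subst]
  congr 1
  funext i
  fin_cases i <;> rfl

theorem EqE.pT_congr {s s' t t' : Term SigD} (h₁ : EqE DTheory s s') (h₂ : EqE DTheory t t') :
    EqE DTheory (pT s t) (pT s' t') :=
  EqE.congr SigD.p (Fin.forall_fin_two.2 ⟨h₁, h₂⟩)

theorem EqE.mT_pT (s t u : Term SigD) : EqE DTheory (mT u (pT s t)) (pT (mT u s) (mT u t)) := by
  have h := EqE.ax (E := DTheory) (fun n => if n = 0 then s else if n = 1 then t else u)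
    (Or.inl rfl)
  simp only [pT_subst, mT_subst, Term.subst] at h
  exact h

theorem EqE.pT_mT (s t u : Term SigD) : EqE DTheory (mT (pT s t) u) (pT (mT s u) (mT t u)) := by
  have h := EqE.ax (E := DTheory) (fun n => if n = 0 then s else if n = 1 then t else u)
    (Or.inr rfl)
  simp only [pT_subst, mT_subst, Term.subst] at h
  exact h

/-- Interpretation of the signature in a type with addition and multiplication. -/
def ringOp {α : Type} [Add α] [Mul α] : ∀ n, SigD n → (Fin n → α) → α
  | _, .m, a => a 0 * a 1
  | _, .p, a => a 0 + a 1

theorem ringOp_valid {α : Type} [NonUnitalNonAssocSemiring α] :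
    ∀ p ∈ DTheory, ∀ v : ℕ → α, p.1.eval ringOp v = p.2.eval ringOp v := by
  rintro p (rfl | rfl) v
  · simp [mT, pT, Term.eval, ringOp, mul_add]
  · simp [mT, pT, Term.eval, ringOp, add_mul]

theorem isWeight_ringOp : IsWeight (ringOp (α := ℕ)) where
  mono := by
    rintro _ ⟨⟩ a b ha h
    · exact Nat.mul_le_mul (h 0) (h 1)
    · exact add_le_add (h 0) (h 1)
  strict := by
    rintro _ ⟨⟩ a b ha h heq
    · have h₀ := h 0
      have h₁ := h 1
      have a₀ := ha 0
      have a₁ := ha 1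
      simp only [ringOp] at heq
      refine Fin.forall_fin_two.2 ⟨?_, ?_⟩ <;> nlinarith
    · have h₀ := h 0
      have h₁ := h 1
      simp only [ringOp] at heq
      refine Fin.forall_fin_two.2 ⟨?_, ?_⟩ <;> omega
  two_lt := by
    rintro _ ⟨⟩ a ha
    · have h₀ := ha 0
      have h₁ := ha 1
      simp only [ringOp]
      nlinarith
    · have h₀ := ha 0
      have h₁ := ha 1
      simp only [ringOp]
      omega

theorem regular_DTheory : Regular DTheory := by
  rintro p (rfl | rfl)
  · ext; simp [mT, pT, Term.vars, Fin.exists_fin_two]; tauto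
  · ext; simp [mT, pT, Term.vars, Fin.exists_fin_two]; tauto

/-- A term that commutes with a variable `u` contains no other variable. -/
theorem vars_subset_of_commute {t : Term SigD} {u : ℕ}
    (h : EqE DTheory (mT t (.var u)) (mT (.var u) t)) : t.vars ⊆ {u} := by
  let v : ℕ → Matrix (Fin 2) (Fin 2) ℕ := fun x => if x = u then !![1, 0; 0, 2] else !![1, 1; 0, 1]
  have hdiag : ∀ s : Term SigD, 0 < s.eval ringOp v 0 0 ∧ 0 < s.eval ringOp v 1 1 := by
    intro s
    induction s with
    | var x => by_cases hx : x = u <;> simp [Term.eval, v, hx]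
    | app n g ts ih =>
      cases g
      · have h₀ := ih 0
        have h₁ := ih 1
        simp only [Term.eval, ringOp, Matrix.mul_apply, Fin.sum_univ_two]
        exact ⟨Nat.add_pos_left (Nat.mul_pos h₀.1 h₁.1) _,
          Nat.add_pos_right _ (Nat.mul_pos h₀.2 h₁.2)⟩
      · exact ⟨Nat.add_pos_left (ih 0).1 _, Nat.add_pos_left (ih 0).2 _⟩
  have hoff : ∀ s : Term SigD, ∀ x ∈ s.vars, x ≠ u → 0 < s.eval ringOp v 0 1 := by
    intro s
    induction s with
    | var y =>
      rintro x rfl hx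
      simp [Term.eval, v, hx]
    | app n g ts ih =>
      intro x hx hxu
      obtain ⟨i, hi⟩ := Set.mem_iUnion.1 hx
      have hpos := ih i x hi hxu
      cases g
      · have h₀ := hdiag (ts 0)
        have h₁ := hdiag (ts 1)
        simp only [Term.eval, ringOp, Matrix.mul_apply, Fin.sum_univ_two]
        obtain rfl | rfl : i = 0 ∨ i = 1 := by omega
        · exact Nat.add_pos_right _ (Nat.mul_pos hpos h₁.2)
        · exact Nat.add_pos_left (Nat.mul_pos h₀.1 hpos) _
      · obtain rfl | rfl : i = 0 ∨ i = 1 := by omega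
        · exact Nat.add_pos_left hpos _
        · exact Nat.add_pos_right _ hpos
  intro x hx
  by_contra hxu
  have hpos := hoff t x hx hxu
  have heq := congrFun (congrFun (h.eval_eq ringOp_valid v) 0) 1
  simp [mT, Term.eval, ringOp, Matrix.mul_apply, Fin.sum_univ_two, v] at heq
  change t.eval ringOp v 0 1 * 2 = t.eval ringOp v 0 1 at heq
  omega

/-- The left-nested sum of `n + 1` copies of the variable `1`. -/
def leftSum : ℕ → Term SigD
  | 0 => .var 1
  | n + 1 => pT (leftSum n) (.var 1)

theorem leftSum_commute (n : ℕ) :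
    EqE DTheory (mT (leftSum n) (.var 1)) (mT (.var 1) (leftSum n)) := by
  induction n with
  | zero => exact EqE.refl _
  | succ n ih =>
    exact (EqE.pT_mT _ _ _).trans ((EqE.pT_congr ih (EqE.refl _)).trans (EqE.mT_pT _ _ _).symm)

theorem lt_weight_leftSum (n : ℕ) : n < (leftSum n).weight ringOp := by
  induction n with
  | zero => exact Nat.two_pos
  | succ n ih =>
    have h : (leftSum (n + 1)).weight ringOp = (leftSum n).weight ringOp + 2 := rfl
    omega

/-- The problem `xy = yx`. -/
def commProblem : Set (Term SigD × Term SigD) := {(mT (.var 0) (.var 1), mT (.var 1) (.var 0))}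

/-- The substitution that maps the variable `0` to `leftSum n`. -/
def commSol (n : ℕ) : Subst SigD where
  toFun x := if x = 0 then leftSum n else .var x
  finite_dom := by
    refine (Set.finite_singleton 0).subset fun x hx => ?_
    by_contra h
    exact hx (if_neg h)

theorem unifier_commSol (n : ℕ) : Unifier DTheory commProblem (commSol n) := by
  rintro p rfl
  simp only [mT_subst]
  exact leftSum_commute n

theorem not_completeSet_commProblem (S : Set (Subst SigD)) (hS : S.Finite) :
    ¬ CompleteSet DTheory commProblem Set.univ S := by
  rintro ⟨hu, hc⟩
  obtain ⟨b, hb⟩ := (hS.image fun σ => (σ.toFun 0).weight ringOp).bddAbove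
  obtain ⟨σ, hσ, lam, hl⟩ := hc _ (unifier_commSol b)
  have h₀ : EqE DTheory ((σ.toFun 0).subst lam.toFun) (leftSum b) := hl 0 trivial
  have h₁ : EqE DTheory ((σ.toFun 1).subst lam.toFun) (.var 1) := hl 1 trivial
  have hop := isWeight_ringOp
  have hw₁ : ((σ.toFun 1).subst lam.toFun).weight ringOp = 2 := h₁.eval_eq ringOp_valid _
  have hle := hop.le_subst lam.toFun (σ.toFun 1)
  have hge := hop.two_le (σ.toFun 1)
  obtain ⟨u, hu₁⟩ := hop.eq_var (t := σ.toFun 1) (by omega)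
  have hcomm := hu σ hσ _ rfl
  simp only [mT_subst, Term.subst, hu₁] at hcomm
  have hsub := vars_subset_of_commute hcomm
  rw [hu₁] at hw₁
  have hconst : ((σ.toFun 0).subst lam.toFun).weight ringOp = (σ.toFun 0).weight ringOp := by
    rw [Term.weight, Term.eval_subst]
    exact Term.eval_congr fun x hx => by rw [hsub hx]; exact hw₁
  have hw₀ : ((σ.toFun 0).subst lam.toFun).weight ringOp = (leftSum b).weight ringOp :=
    h₀.eval_eq ringOp_valid _
  have hbσ := hb ⟨σ, hσ, rfl⟩
  have hlt := lt_weight_leftSum b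
  change (σ.toFun 0).weight ringOp ≤ b at hbσ
  omega

end Distributivity

/-- Theorem `Distr:AC:thm`: the unrestricted unification
type of `AC` and of `D` for elementary unification is infinitary. -/
theorem stmt17 : UnrestrictedTypeInfinitary ACTheory ∧ UnrestrictedTypeInfinitary DTheory :=
  ⟨unrestrictedTypeInfinitary_of_wellFounded
      (wellFounded_instLT regular_ACTheory isWeight_addOp addOp_valid)
      (Set.finite_singleton _) ⟨acSol 3, unifier_acSol 3⟩ not_completeSet_acProblem,
    unrestrictedTypeInfinitary_of_wellFounded
      (wellFounded_instLT regular_DTheory isWeight_ringOp ringOp_valid)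
      (Set.finite_singleton _) ⟨commSol 0, unifier_commSol 0⟩ not_completeSet_commProblem⟩

end UnifFW
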